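/- Let α ∈ (-1,1) and q ∈ (0,1). For every integer k ≥ 0 one has (-α;q)_∞ · (q;q)_∞ · ∑_{n=0}^∞ (q^n / (q;q)_n) · h_n(-α q^{-1} | q) · (q^n/(1-q))^k = (-α;q)_k · [k]_q!, where the series converges absolutely. (Equivalently: the discrete signed measure ρ_{ν_{α,q}} = (-α,q;q)_∞ ∑_{n=0}^∞ (q^n/(q;q)_n) h_n(-α q^{-1}|q) δ_{(1-q)^{-1/2} q^{n/2}} has (2k)-th moment (-α;q)_k [k]_q!.) -/

import Mathlib

/-- The q-Pochhammer symbol `(a;q)_k = ∏_{i=0}^{k-1} (1 - a q^i)`. -/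
noncomputable def qPoch (a q : ℝ) (k : ℕ) : ℝ :=
  ∏ i ∈ Finset.range k, (1 - a * q ^ i)

/-- The infinite q-Pochhammer symbol `(a;q)_∞ = ∏_{i=0}^{∞} (1 - a q^i)`. -/
noncomputable def qPochInf (a q : ℝ) : ℝ :=
  ∏' i : ℕ, (1 - a * q ^ i)

/-- The q-factorial `[k]_q! = ∏_{ℓ=1}^k (1 + q + ⋯ + q^{ℓ-1})`. -/
noncomputable def qFact (q : ℝ) (k : ℕ) : ℝ :=
  ∏ l ∈ Finset.range k, (∑ i ∈ Finset.range (l + 1), q ^ i)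

/-- The q-binomial coefficient `[n choose l]_q = (q;q)_n / ((q;q)_l (q;q)_{n-l})`. -/
noncomputable def qBinom (q : ℝ) (n l : ℕ) : ℝ :=
  qPoch q q n / (qPoch q q l * qPoch q q (n - l))

/-- The Rogers–Szegő polynomial `h_n(x|q) = ∑_{l=0}^n [n choose l]_q x^l`. -/
noncomputable def rogersSzego (q : ℝ) (n : ℕ) (x : ℝ) : ℝ :=
  ∑ l ∈ Finset.range (n + 1), qBinom q n l * x ^ l

open Filter Topology

theorem qPoch_succ (a q : ℝ) (n : ℕ) : qPoch a q (n + 1) = qPoch a q n * (1 - a * q ^ n) :=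
  Finset.prod_range_succ _ _

theorem qPoch_self_pos {q : ℝ} (hq0 : 0 < q) (hq1 : q < 1) (n : ℕ) : 0 < qPoch q q n := by
  refine Finset.prod_pos fun i _ => ?_
  rw [← pow_succ', sub_pos]
  exact pow_lt_one₀ hq0.le hq1 i.succ_ne_zero

theorem qPoch_self_eq {q : ℝ} (k : ℕ) : qPoch q q k = (1 - q) ^ k * qFact q k := by
  unfold qPoch qFact
  rw [← Finset.card_range k, ← Finset.prod_const, Finset.card_range, ← Finset.prod_mul_distrib]
  refine Finset.prod_congr rfl fun l _ => ?_
  rw [mul_neg_geom_sum, pow_succ']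

theorem tendsto_qPoch {q : ℝ} (hq0 : 0 < q) (hq1 : q < 1) (a : ℝ) :
    Tendsto (qPoch a q) atTop (𝓝 (qPochInf a q)) := by
  have hs : Summable fun i : ℕ => ‖-(a * q ^ i)‖ := by
    simpa only [norm_neg] using ((summable_geometric_of_lt_one hq0.le hq1).mul_left a).norm
  have hm := multipliable_one_add_of_summable hs
  simp only [← sub_eq_add_neg] at hm
  exact hm.hasProd.tendsto_prod_nat

theorem summable_norm_pow_div_qPoch {q x : ℝ} (hq0 : 0 < q) (hq1 : q < 1) (hx : |x| < 1) :
    Summable fun n : ℕ => ‖x ^ n / qPoch q q n‖ := by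
  obtain ⟨r, hxr, hr⟩ := exists_between hx
  have hlim : Tendsto (fun n : ℕ => r * (1 - q * q ^ n)) atTop (𝓝 r) := by
    simpa using (((tendsto_pow_atTop_nhds_zero_of_lt_one hq0.le hq1).const_mul q).const_sub
      1).const_mul r
  refine summable_of_ratio_norm_eventually_le hr ?_
  filter_upwards [hlim.eventually (lt_mem_nhds hxr)] with n hn
  have hpos := qPoch_self_pos hq0 hq1 n
  have hpos' := qPoch_self_pos hq0 hq1 (n + 1)
  rw [norm_norm, norm_norm, norm_div, norm_div, Real.norm_of_nonneg hpos.le,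
    Real.norm_of_nonneg hpos'.le, div_le_iff₀ hpos', qPoch_succ, norm_pow, norm_pow,
    Real.norm_eq_abs, pow_succ]
  calc |x| ^ n * |x| ≤ |x| ^ n * (r * (1 - q * q ^ n)) := by gcongr
    _ = _ := by field_simp

/-- The series `∑ xⁿ / (q;q)_n`, one of Euler's two `q`-exponential functions. -/
noncomputable def qExp (q x : ℝ) : ℝ := ∑' n : ℕ, x ^ n / qPoch q q n

theorem one_sub_mul_qExp {q x : ℝ} (hq0 : 0 < q) (hq1 : q < 1) (hx : |x| < 1) :
    (1 - x) * qExp q x = qExp q (x * q) := by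
  have hxq : |x * q| < 1 := by
    rw [abs_mul, abs_of_pos hq0]
    nlinarith [abs_nonneg x]
  have hs := (summable_norm_pow_div_qPoch hq0 hq1 hx).of_norm
  have hs' := (summable_norm_pow_div_qPoch hq0 hq1 hxq).of_norm
  suffices h : qExp q x - qExp q (x * q) = x * qExp q x by linarith
  unfold qExp
  rw [← hs.tsum_sub hs', (hs.sub hs').tsum_eq_zero_add, ← tsum_mul_left]
  simp only [pow_zero, sub_self, zero_add]
  refine tsum_congr fun n => ?_
  have h := (qPoch_self_pos hq0 hq1 n).ne'
  have h' := (qPoch_self_pos hq0 hq1 (n + 1)).ne'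
  rw [qPoch_succ] at h' ⊢
  have h'' := right_ne_zero_of_mul h'
  field_simp
  ring

theorem qPoch_mul_qExp {q x : ℝ} (hq0 : 0 < q) (hq1 : q < 1) (hx : |x| < 1) (k : ℕ) :
    qPoch x q k * qExp q x = qExp q (x * q ^ k) := by
  induction k with
  | zero => simp [qPoch]
  | succ k ih =>
    have hxk : |x * q ^ k| < 1 := by
      rw [abs_mul, abs_of_pos (pow_pos hq0 k)]
      exact mul_lt_one_of_nonneg_of_lt_one_left (abs_nonneg x) hx (pow_le_one₀ hq0.le hq1.le)
    rw [qPoch_succ, mul_right_comm, ih, mul_comm, one_sub_mul_qExp hq0 hq1 hxk, pow_succ, mul_assoc]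

theorem tendsto_qExp_mul_pow {q x : ℝ} (hq0 : 0 < q) (hq1 : q < 1) (hx : |x| < 1) :
    Tendsto (fun k : ℕ => qExp q (x * q ^ k)) atTop (𝓝 1) := by
  have hzero : ∑' n : ℕ, (0 : ℝ) ^ n / qPoch q q n = 1 := by
    rw [tsum_eq_single 0 fun n hn => by simp [hn]]
    simp [qPoch]
  rw [← hzero]
  refine tendsto_tsum_of_dominated_convergence (summable_norm_pow_div_qPoch hq0 hq1 hx)
    (fun n => ?_) (Eventually.of_forall fun k n => ?_)
  · have h := (tendsto_pow_atTop_nhds_zero_of_lt_one hq0.le hq1).const_mul x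
    rw [mul_zero] at h
    exact (h.pow n).div_const _
  · rw [norm_div, norm_div, norm_pow, norm_pow]
    gcongr
    rw [norm_mul, Real.norm_of_nonneg (pow_pos hq0 k).le]
    exact mul_le_of_le_one_right (norm_nonneg x) (pow_le_one₀ hq0.le hq1.le)

/-- Euler's identity `∑ xⁿ / (q;q)_n = 1 / (x;q)_∞`. -/
theorem qPochInf_mul_qExp {q x : ℝ} (hq0 : 0 < q) (hq1 : q < 1) (hx : |x| < 1) :
    qPochInf x q * qExp q x = 1 := by
  refine tendsto_nhds_unique ((tendsto_qPoch hq0 hq1 x).mul_const _) ?_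
  simpa only [qPoch_mul_qExp hq0 hq1 hx] using tendsto_qExp_mul_pow hq0 hq1 hx

theorem qPochInf_mul_qExp_mul_pow {q x : ℝ} (hq0 : 0 < q) (hq1 : q < 1) (hx : |x| < 1) (k : ℕ) :
    qPochInf x q * qExp q (x * q ^ k) = qPoch x q k := by
  rw [← qPoch_mul_qExp hq0 hq1 hx, mul_left_comm, qPochInf_mul_qExp hq0 hq1 hx, mul_one]

/-- Homogeneous expansion of the Rogers–Szegő polynomials, as a Cauchy product. -/
theorem pow_div_qPoch_mul_rogersSzego {q : ℝ} (hq0 : 0 < q) (hq1 : q < 1) (x y : ℝ) (n : ℕ) :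
    y ^ n / qPoch q q n * rogersSzego q n x =
      ∑ l ∈ Finset.range (n + 1),
        (x * y) ^ l / qPoch q q l * (y ^ (n - l) / qPoch q q (n - l)) := by
  rw [rogersSzego, Finset.mul_sum]
  refine Finset.sum_congr rfl fun l hl => ?_
  have hn := (qPoch_self_pos hq0 hq1 n).ne'
  have hl' := (qPoch_self_pos hq0 hq1 l).ne'
  have hnl := (qPoch_self_pos hq0 hq1 (n - l)).ne'
  rw [qBinom, ← pow_mul_pow_sub y (Finset.mem_range_succ_iff.mp hl), mul_pow]
  field_simp

/-- The (2k)-th moment of the signed measure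
`ρ_{ν_{α,q}} = (-α,q;q)_∞ ∑_n (q^n/(q;q)_n) h_n(-α q^{-1}|q) δ_{(1-q)^{-1/2} q^{n/2}}`
equals `(-α;q)_k [k]_q!`, the series converging absolutely. -/
theorem moments_of_rho_nu_alpha_q (α q : ℝ) (hα : α ∈ Set.Ioo (-1 : ℝ) 1)
    (hq : q ∈ Set.Ioo (0 : ℝ) 1) (k : ℕ) :
    Summable (fun n : ℕ =>
      |q ^ n / qPoch q q n * rogersSzego q n (-α / q) * (q ^ n / (1 - q)) ^ k|) ∧
    qPochInf (-α) q * qPochInf q q *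
      ∑' n : ℕ, q ^ n / qPoch q q n * rogersSzego q n (-α / q) * (q ^ n / (1 - q)) ^ k
      = qPoch (-α) q k * qFact q k := by
  obtain ⟨hq0, hq1⟩ := hq
  have ha : |-α| < 1 := by rw [abs_neg]; exact abs_lt.mpr hα
  have hq' : |q| < 1 := by rwa [abs_of_pos hq0]
  have hpow : |q ^ k| ≤ 1 := by
    rw [abs_of_pos (pow_pos hq0 k)]
    exact pow_le_one₀ hq0.le hq1.le
  have hx : |-α * q ^ k| < 1 := by
    rw [abs_mul]
    exact mul_lt_one_of_nonneg_of_lt_one_left (abs_nonneg _) ha hpow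
  have hy : |q * q ^ k| < 1 := by
    rw [abs_mul]
    exact mul_lt_one_of_nonneg_of_lt_one_left (abs_nonneg _) hq' hpow
  have hxs := summable_norm_pow_div_qPoch hq0 hq1 hx
  have hys := summable_norm_pow_div_qPoch hq0 hq1 hy
  have hterm : ∀ n : ℕ,
      q ^ n / qPoch q q n * rogersSzego q n (-α / q) * (q ^ n / (1 - q)) ^ k =
        (∑ l ∈ Finset.range (n + 1), (-α * q ^ k) ^ l / qPoch q q l *
          ((q * q ^ k) ^ (n - l) / qPoch q q (n - l))) * ((1 - q) ^ k)⁻¹ := fun n => by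
    have hxy : -α * q ^ k = -α / q * (q * q ^ k) := by field_simp
    rw [hxy, ← pow_div_qPoch_mul_rogersSzego hq0 hq1, div_pow, mul_pow, pow_right_comm q n k]
    ring
  simp only [hterm]
  constructor
  · exact ((summable_norm_sum_mul_range_of_summable_norm hxs hys).of_norm.mul_right _).abs
  · rw [tsum_mul_right, ← tsum_mul_tsum_eq_tsum_sum_range_of_summable_norm hxs hys]
    change qPochInf (-α) q * qPochInf q q *
      (qExp q (-α * q ^ k) * qExp q (q * q ^ k) * ((1 - q) ^ k)⁻¹) = _
    have hne : (1 - q) ^ k ≠ 0 := pow_ne_zero _ (sub_pos.mpr hq1).ne'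
    rw [← mul_assoc, mul_mul_mul_comm, qPochInf_mul_qExp_mul_pow hq0 hq1 ha,
      qPochInf_mul_qExp_mul_pow hq0 hq1 hq', qPoch_self_eq]
    field_simp
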